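/- arXiv:0802.0420 — 2 statements merged into one kernel-verified Lean document; each statement's English description precedes it below -/
import Mathlib

section
/- Let a, b ≥ 3 be coprime integers, let Δ = conv{(0,0),(b,0),(0,a)} ⊂ ℝ², and set g = (a−1)(b−1)/2. If g ≥ 6, then #(Δ ∩ ℤ²) − c(Δ) − 3 < 2g − 1. -/
noncomputable section

/-- The embedding of the integer lattice `ℤ²` into the plane `ℝ²`. -/
def toR2 (p : ℤ × ℤ) : ℝ × ℝ := ((p.1 : ℝ), (p.2 : ℝ))

/-- A lattice polytope in `ℝ²`: the convex hull of a finite set of lattice points. -/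
def IsLatticePolytope (Δ : Set (ℝ × ℝ)) : Prop :=
  ∃ S : Finset (ℤ × ℤ), Δ = convexHull ℝ (toR2 '' (S : Set (ℤ × ℤ)))

/-- The lattice points of `Δ`. -/
def latticePts (Δ : Set (ℝ × ℝ)) : Set (ℤ × ℤ) := {p | toR2 p ∈ Δ}

/-- The interior lattice points of `Δ`. -/
def intPts (Δ : Set (ℝ × ℝ)) : Set (ℤ × ℤ) := {p | toR2 p ∈ interior Δ}

/-- The boundary lattice points of `Δ`. -/
def bdPts (Δ : Set (ℝ × ℝ)) : Set (ℤ × ℤ) := {p | toR2 p ∈ frontier Δ}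

/-- `Δ⁽¹⁾`: the convex hull of the interior lattice points of `Δ`. -/
def interiorHull (Δ : Set (ℝ × ℝ)) : Set (ℝ × ℝ) := convexHull ℝ (toR2 '' intPts Δ)

/-- `Δ` is maximal: any lattice polytope strictly containing `Δ` has a different set of
interior lattice points. -/
def IsMaximalPolytope (Δ : Set (ℝ × ℝ)) : Prop :=
  ∀ Δ' : Set (ℝ × ℝ), IsLatticePolytope Δ' → Δ ⊂ Δ' → intPts Δ' ≠ intPts Δ

/-- `Δ` is hyperelliptic: its interior lattice points are collinear. -/
def IsHyperelliptic (Δ : Set (ℝ × ℝ)) : Prop := Collinear ℝ (toR2 '' intPts Δ)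

/-- A facet (edge) of `Δ`: a one-dimensional exposed face. -/
def IsFacet (Δ τ : Set (ℝ × ℝ)) : Prop :=
  IsExposed ℝ Δ τ ∧ Collinear ℝ τ ∧ ¬ τ.Subsingleton

/-- `v` is a column vector of `Δ`: `v ≠ 0` and there is a facet `τ` (the base facet)
such that `v + ((Δ ∖ τ) ∩ ℤ²) ⊆ Δ`. -/
def IsColumnVector (Δ : Set (ℝ × ℝ)) (v : ℤ × ℤ) : Prop :=
  v ≠ 0 ∧ ∃ τ : Set (ℝ × ℝ), IsFacet Δ τ ∧
    ∀ p : ℤ × ℤ, toR2 p ∈ Δ \ τ → toR2 (p + v) ∈ Δ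

/-- `c(Δ)`: the number of column vectors of `Δ`. -/
def colCount (Δ : Set (ℝ × ℝ)) : ℕ := {v : ℤ × ℤ | IsColumnVector Δ v}.ncard

/-- The right triangle with vertices `(0,0)`, `(b,0)`, `(0,a)`, given by its facet inequalities. -/
theorem convexHull_right_triangle {a b : ℝ} (ha : 0 < a) (hb : 0 < b) :
    convexHull ℝ ({((0 : ℝ), (0 : ℝ)), (b, 0), (0, a)} : Set (ℝ × ℝ)) =
      {p | 0 ≤ p.1 ∧ 0 ≤ p.2 ∧ a * p.1 + b * p.2 ≤ a * b} := by
  apply Set.Subset.antisymm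
  · apply convexHull_min
    · rintro p (rfl | rfl | rfl)
      · simp only [Set.mem_ofPred_eq]
        exact ⟨le_rfl, le_rfl, by nlinarith⟩
      · simp only [Set.mem_ofPred_eq]
        exact ⟨hb.le, le_rfl, by nlinarith⟩
      · simp only [Set.mem_ofPred_eq]
        exact ⟨le_rfl, ha.le, by nlinarith⟩
    · rintro ⟨x, y⟩ ⟨hx, hy, hxy⟩ ⟨x', y'⟩ ⟨hx', hy', hxy'⟩ s t hs ht hst
      simp only [Set.mem_ofPred_eq, Prod.smul_mk, Prod.mk_add_mk, smul_eq_mul] at *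
      refine ⟨by positivity, by positivity, ?_⟩
      calc a * (s * x + t * x') + b * (s * y + t * y')
          = s * (a * x + b * y) + t * (a * x' + b * y') := by ring
        _ ≤ s * (a * b) + t * (a * b) := by gcongr
        _ = a * b := by rw [← add_mul, hst, one_mul]
  · rintro ⟨x, y⟩ ⟨hx, hy, hxy⟩
    simp only at hx hy hxy
    have hsum : x / b + y / a ≤ 1 := by
      rw [div_add_div _ _ hb.ne' ha.ne', div_le_one (by positivity)]
      linarith
    have hmem := (convex_convexHull ℝ
      ({((0 : ℝ), (0 : ℝ)), (b, 0), (0, a)} : Set (ℝ × ℝ))).sum_mem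
      (t := Finset.univ) (w := ![1 - x / b - y / a, x / b, y / a])
      (z := ![(0, 0), (b, 0), (0, a)])
      (by
        intro i _
        fin_cases i
        · simp only [Fin.zero_eta, Matrix.cons_val_zero]
          linarith
        · exact div_nonneg hx hb.le
        · exact div_nonneg hy ha.le)
      (by
        simp only [Fin.sum_univ_three, Matrix.cons_val]
        ring)
      (by
        intro i _
        apply subset_convexHull
        fin_cases i <;> simp)
    simpa [Fin.sum_univ_three, hb.ne', ha.ne'] using hmem

/-- Lattice points of the triangle `conv {(0,0), (b,0), (0,a)}`, as a finite set. -/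
def triangleFinset (a b : ℕ) : Finset (ℤ × ℤ) :=
  (Finset.Icc 0 (b : ℤ) ×ˢ Finset.Icc 0 (a : ℤ)).filter
    fun p => (a : ℤ) * p.1 + b * p.2 ≤ a * b

theorem mem_triangleFinset {a b : ℕ} (ha : 0 < a) (hb : 0 < b) {p : ℤ × ℤ} :
    p ∈ triangleFinset a b ↔ 0 ≤ p.1 ∧ 0 ≤ p.2 ∧ (a : ℤ) * p.1 + b * p.2 ≤ a * b := by
  have ha' : (0 : ℤ) < a := by exact_mod_cast ha
  have hb' : (0 : ℤ) < b := by exact_mod_cast hb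
  simp only [triangleFinset, Finset.mem_filter, Finset.mem_product, Finset.mem_Icc]
  refine ⟨fun h => ⟨h.1.1.1, h.1.2.1, h.2⟩, fun ⟨h1, h2, h3⟩ => ⟨⟨⟨h1, ?_⟩, h2, ?_⟩, h3⟩⟩
  · nlinarith
  · nlinarith

theorem toR2_mem_triangle_iff {a b : ℕ} (ha : 0 < a) (hb : 0 < b) {p : ℤ × ℤ} :
    toR2 p ∈ convexHull ℝ
        ({((0 : ℝ), (0 : ℝ)), ((b : ℝ), 0), (0, (a : ℝ))} : Set (ℝ × ℝ)) ↔
      0 ≤ p.1 ∧ 0 ≤ p.2 ∧ (a : ℤ) * p.1 + b * p.2 ≤ a * b := by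
  rw [convexHull_right_triangle (by exact_mod_cast ha) (by exact_mod_cast hb)]
  simp only [toR2, Set.mem_ofPred_eq]
  norm_cast

theorem latticePts_triangle {a b : ℕ} (ha : 0 < a) (hb : 0 < b) :
    latticePts (convexHull ℝ
        ({((0 : ℝ), (0 : ℝ)), ((b : ℝ), 0), (0, (a : ℝ))} : Set (ℝ × ℝ))) =
      triangleFinset a b := by
  ext p
  rw [Finset.mem_coe, mem_triangleFinset ha hb]
  exact toR2_mem_triangle_iff ha hb

/-- The triangle and its image under the half-turn of the rectangle `[0,b] × [0,a]` cover the
lattice points of the rectangle and share only the two endpoints of the hypotenuse. -/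
theorem two_mul_card_triangleFinset {a b : ℕ} (ha : 0 < a) (hb : 0 < b)
    (hab : Nat.Coprime a b) :
    2 * (triangleFinset a b).card = (a + 1) * (b + 1) + 2 := by
  have ha' : (0 : ℤ) < a := by exact_mod_cast ha
  have hb' : (0 : ℤ) < b := by exact_mod_cast hb
  let R : Finset (ℤ × ℤ) := Finset.Icc 0 (b : ℤ) ×ˢ Finset.Icc 0 (a : ℤ)
  let U : Finset (ℤ × ℤ) := R.filter fun p => (a : ℤ) * b ≤ a * p.1 + b * p.2
  have hcard : (triangleFinset a b).card = U.card := by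
    apply Finset.card_bij' (fun p _ => ((b : ℤ) - p.1, (a : ℤ) - p.2))
      (fun p _ => ((b : ℤ) - p.1, (a : ℤ) - p.2))
    · intro p hp
      simp only [triangleFinset, U, R, Finset.mem_filter, Finset.mem_product,
        Finset.mem_Icc] at hp ⊢
      refine ⟨by omega, by nlinarith⟩
    · intro p hp
      simp only [triangleFinset, U, R, Finset.mem_filter, Finset.mem_product,
        Finset.mem_Icc] at hp ⊢
      refine ⟨by omega, by nlinarith⟩
    · simp
    · simp
  have hunion : triangleFinset a b ∪ U = R := by
    ext p
    simp only [triangleFinset, U, R, Finset.mem_union, Finset.mem_filter]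
    rcases le_total ((a : ℤ) * p.1 + b * p.2) (a * b) with h | h <;>
      simp +contextual only [h, and_true, or_iff_left_iff_imp, or_iff_right_iff_imp, implies_true]
  have hinter : triangleFinset a b ∩ U = {((b : ℤ), (0 : ℤ)), (0, (a : ℤ))} := by
    ext ⟨x, y⟩
    simp only [triangleFinset, U, R, Finset.mem_inter, Finset.mem_filter, Finset.mem_product,
      Finset.mem_Icc, Finset.mem_insert, Finset.mem_singleton, Prod.mk.injEq]
    constructor
    · rintro ⟨⟨⟨⟨hx, hx'⟩, hy, hy'⟩, hle⟩, -, hge⟩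
      have heq : (a : ℤ) * x + b * y = a * b := le_antisymm hle hge
      have hdvd : (b : ℤ) ∣ x := by
        apply IsCoprime.dvd_of_dvd_mul_left (Nat.isCoprime_iff_coprime.mpr hab.symm)
        exact ⟨a - y, by linear_combination heq⟩
      obtain ⟨k, rfl⟩ := hdvd
      have hk0 : 0 ≤ k := by nlinarith
      have hk1 : k ≤ 1 := by nlinarith
      interval_cases k
      · right
        exact ⟨by simp, by nlinarith⟩
      · left
        exact ⟨by simp, by nlinarith⟩
    · rintro (⟨rfl, rfl⟩ | ⟨rfl, rfl⟩)
      · refine ⟨⟨⟨⟨?_, ?_⟩, ?_, ?_⟩, ?_⟩, ⟨⟨?_, ?_⟩, ?_, ?_⟩, ?_⟩ <;> nlinarith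
      · refine ⟨⟨⟨⟨?_, ?_⟩, ?_, ?_⟩, ?_⟩, ⟨⟨?_, ?_⟩, ?_, ?_⟩, ?_⟩ <;> nlinarith
  have hpair : ({((b : ℤ), (0 : ℤ)), (0, (a : ℤ))} : Finset (ℤ × ℤ)).card = 2 := by
    apply Finset.card_pair
    simp [hb.ne']
  have hR : R.card = (a + 1) * (b + 1) := by
    simp only [R, Finset.card_product, Int.card_Icc]
    rw [mul_comm]
    congr 1
  have := Finset.card_union_add_card_inter (triangleFinset a b) U
  rw [hunion, hinter, hpair, hR, ← hcard] at this
  omega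

/-- The bottom edge of the triangle is a facet. -/
theorem isFacet_bottom {a b : ℝ} (ha : 0 < a) (hb : 0 < b) :
    IsFacet {p : ℝ × ℝ | 0 ≤ p.1 ∧ 0 ≤ p.2 ∧ a * p.1 + b * p.2 ≤ a * b}
      {p | (0 ≤ p.1 ∧ 0 ≤ p.2 ∧ a * p.1 + b * p.2 ≤ a * b) ∧ p.2 = 0} := by
  refine ⟨fun _ => ⟨-ContinuousLinearMap.snd ℝ ℝ ℝ, ?_⟩, ?_, ?_⟩
  · ext p
    simp only [Set.mem_ofPred_eq, neg_apply, ContinuousLinearMap.coe_snd',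
      neg_le_neg_iff]
    refine and_congr_right fun hp => ⟨fun h q hq => h ▸ hq.2.1, fun h => ?_⟩
    exact le_antisymm (h (0, 0) ⟨le_rfl, le_rfl, by simp; positivity⟩) hp.2.1
  · rw [collinear_iff_of_mem (p₀ := (0, 0)) (by simp; positivity)]
    refine ⟨(1, 0), fun p hp => ⟨p.1, ?_⟩⟩
    ext <;> simp [hp.2]
  · intro h
    have := @h (0, 0) (by simp; positivity) (b, 0) (by simp [hb.le])
    simp [hb.ne] at this

/-- The left edge of the triangle is a facet. -/
theorem isFacet_left {a b : ℝ} (ha : 0 < a) (hb : 0 < b) :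
    IsFacet {p : ℝ × ℝ | 0 ≤ p.1 ∧ 0 ≤ p.2 ∧ a * p.1 + b * p.2 ≤ a * b}
      {p | (0 ≤ p.1 ∧ 0 ≤ p.2 ∧ a * p.1 + b * p.2 ≤ a * b) ∧ p.1 = 0} := by
  refine ⟨fun _ => ⟨-ContinuousLinearMap.fst ℝ ℝ ℝ, ?_⟩, ?_, ?_⟩
  · ext p
    simp only [Set.mem_ofPred_eq, neg_apply, ContinuousLinearMap.coe_fst',
      neg_le_neg_iff]
    refine and_congr_right fun hp => ⟨fun h q hq => h ▸ hq.1, fun h => ?_⟩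
    exact le_antisymm (h (0, 0) ⟨le_rfl, le_rfl, by simp; positivity⟩) hp.1
  · rw [collinear_iff_of_mem (p₀ := (0, 0)) (by simp; positivity)]
    refine ⟨(0, 1), fun p hp => ⟨p.2, ?_⟩⟩
    ext <;> simp [hp.2]
  · intro h
    have := @h (0, 0) (by simp; positivity) (0, a) (by simp [ha.le, mul_comm])
    simp [ha.ne] at this

theorem isColumnVector_down {a b : ℕ} (ha : 0 < a) (hb : 0 < b) {k : ℕ} (hk : k ≤ b / a) :
    IsColumnVector (convexHull ℝ
        ({((0 : ℝ), (0 : ℝ)), ((b : ℝ), 0), (0, (a : ℝ))} : Set (ℝ × ℝ))) ((k : ℤ), -1) := by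
  have ha' : (0 : ℝ) < a := by exact_mod_cast ha
  have hb' : (0 : ℝ) < b := by exact_mod_cast hb
  have hka : (k : ℤ) * a ≤ b := by exact_mod_cast (Nat.le_div_iff_mul_le ha).mp hk
  have hfacet := isFacet_bottom ha' hb'
  rw [← convexHull_right_triangle ha' hb'] at hfacet
  refine ⟨by simp, _, hfacet, ?_⟩
  rintro p ⟨hp, hpτ⟩
  rw [toR2_mem_triangle_iff ha hb] at hp ⊢
  have hp2 : p.2 ≠ 0 := by
    intro h
    have h' := (toR2_mem_triangle_iff ha hb).mpr hp
    rw [convexHull_right_triangle ha' hb'] at h'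
    exact hpτ ⟨h', by simp [toR2, h]⟩
  simp only [Prod.fst_add, Prod.snd_add]
  exact ⟨by omega, by omega, by nlinarith⟩

theorem isColumnVector_left {a b : ℕ} (ha : 0 < a) (hb : 0 < b) {k : ℕ} (hk : k ≤ a / b) :
    IsColumnVector (convexHull ℝ
        ({((0 : ℝ), (0 : ℝ)), ((b : ℝ), 0), (0, (a : ℝ))} : Set (ℝ × ℝ))) (-1, (k : ℤ)) := by
  have ha' : (0 : ℝ) < a := by exact_mod_cast ha
  have hb' : (0 : ℝ) < b := by exact_mod_cast hb
  have hkb : (k : ℤ) * b ≤ a := by exact_mod_cast (Nat.le_div_iff_mul_le hb).mp hk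
  have hfacet := isFacet_left ha' hb'
  rw [← convexHull_right_triangle ha' hb'] at hfacet
  refine ⟨by simp, _, hfacet, ?_⟩
  rintro p ⟨hp, hpτ⟩
  rw [toR2_mem_triangle_iff ha hb] at hp ⊢
  have hp1 : p.1 ≠ 0 := by
    intro h
    have h' := (toR2_mem_triangle_iff ha hb).mpr hp
    rw [convexHull_right_triangle ha' hb'] at h'
    exact hpτ ⟨h', by simp [toR2, h]⟩
  simp only [Prod.fst_add, Prod.snd_add]
  exact ⟨by omega, by omega, by nlinarith⟩

/-- A set with finitely many lattice points, not all collinear, has finitely many column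
vectors. -/
theorem finite_isColumnVector {Δ : Set (ℝ × ℝ)} (hfin : (latticePts Δ).Finite)
    (hΔ : ¬ Collinear ℝ (toR2 '' latticePts Δ)) : {v | IsColumnVector Δ v}.Finite := by
  refine (hfin.image2 (fun p q => q - p) hfin).subset ?_
  rintro v ⟨-, τ, ⟨-, hτ, -⟩, h⟩
  obtain ⟨p, hp, hpτ⟩ : ∃ p ∈ latticePts Δ, toR2 p ∉ τ := by
    by_contra! hall
    exact hΔ (hτ.subset (Set.image_subset_iff.mpr hall))
  exact ⟨p, hp, p + v, h p ⟨hp, hpτ⟩, by simp⟩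

theorem not_collinear_latticePts_triangle {a b : ℕ} (ha : 0 < a) (hb : 0 < b) :
    ¬ Collinear ℝ (toR2 '' latticePts (convexHull ℝ
        ({((0 : ℝ), (0 : ℝ)), ((b : ℝ), 0), (0, (a : ℝ))} : Set (ℝ × ℝ)))) := by
  intro h
  have hmem : ∀ p : ℤ × ℤ, 0 ≤ p.1 ∧ 0 ≤ p.2 ∧ (a : ℤ) * p.1 + b * p.2 ≤ a * b →
      toR2 p ∈ toR2 '' latticePts (convexHull ℝ
        ({((0 : ℝ), (0 : ℝ)), ((b : ℝ), 0), (0, (a : ℝ))} : Set (ℝ × ℝ))) :=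
    fun p hp => Set.mem_image_of_mem _ ((toR2_mem_triangle_iff ha hb).mpr hp)
  rw [collinear_iff_of_mem (hmem (0, 0) (by simp; positivity))] at h
  obtain ⟨v, hv⟩ := h
  obtain ⟨r, hr⟩ := hv _ (hmem (b, 0) (by simp))
  obtain ⟨s, hs⟩ := hv _ (hmem (0, a) (by simp [mul_comm]))
  simp only [toR2, vadd_eq_add, Prod.ext_iff, Prod.fst_add, Prod.snd_add, Prod.smul_fst,
    Prod.smul_snd, smul_eq_mul, Int.cast_natCast, Int.cast_zero, add_zero] at hr hs
  have ha' : (0 : ℝ) < a := by exact_mod_cast ha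
  have hb' : (0 : ℝ) < b := by exact_mod_cast hb
  have : (a : ℝ) * b = 0 := by
    linear_combination a * hr.1 + r * v.1 * hs.2 - s * v.1 * hr.2
  nlinarith [mul_pos ha' hb']

theorem le_colCount_triangle {a b : ℕ} (ha : 0 < a) (hb : 0 < b) :
    b / a + a / b + 2 ≤ colCount (convexHull ℝ
        ({((0 : ℝ), (0 : ℝ)), ((b : ℝ), 0), (0, (a : ℝ))} : Set (ℝ × ℝ))) := by
  let D : Finset (ℤ × ℤ) := (Finset.range (b / a + 1)).image fun k : ℕ => ((k : ℤ), -1)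
  let L : Finset (ℤ × ℤ) := (Finset.range (a / b + 1)).image fun k : ℕ => (-1, (k : ℤ))
  have hD : D.card = b / a + 1 := by
    rw [Finset.card_image_of_injective _ fun x y h => by simpa using h, Finset.card_range]
  have hL : L.card = a / b + 1 := by
    rw [Finset.card_image_of_injective _ fun x y h => by simpa using h, Finset.card_range]
  have hdisj : Disjoint D L := by
    simp only [D, L, Finset.disjoint_left, Finset.mem_image]
    rintro _ ⟨k, -, rfl⟩ ⟨l, -, h⟩
    have := congrArg Prod.fst h
    simp only at this
    omega
  have hcard : (D ∪ L).card = b / a + a / b + 2 := by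
    rw [Finset.card_union_of_disjoint hdisj, hD, hL]
    omega
  rw [← hcard, ← Set.ncard_coe_finset]
  refine Set.ncard_le_ncard ?_ (finite_isColumnVector ?_
    (not_collinear_latticePts_triangle ha hb))
  · intro v hv
    simp only [D, L, Finset.coe_union, Finset.coe_image, Set.mem_union, Set.mem_image,
      Finset.mem_coe, Finset.mem_range, Nat.lt_succ_iff] at hv
    rcases hv with ⟨k, hk, rfl⟩ | ⟨k, hk, rfl⟩
    · exact isColumnVector_down ha hb hk
    · exact isColumnVector_left ha hb hk
  · rw [latticePts_triangle ha hb]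
    exact Finset.finite_toSet _

/-- With `2g = (a - 1) * (b - 1)` even, this says `a + b ≤ g + b / a + 2`. -/
theorem two_mul_add_le_of_lt {a b : ℕ} (ha : 3 ≤ a) (hlt : a < b)
    (hg : 12 ≤ (a - 1) * (b - 1)) :
    2 * (a + b) ≤ (a - 1) * (b - 1) + 2 * (b / a + 2) + 1 := by
  obtain ⟨m, rfl⟩ := Nat.exists_eq_add_of_le' ha
  obtain ⟨n, rfl⟩ := Nat.exists_eq_add_of_lt hlt
  have hdiv : 1 ≤ (m + 3 + n + 1) / (m + 3) := (Nat.one_le_div_iff (by omega)).mpr (by omega)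
  rcases m with _ | _ | m
  · simp only [Nat.zero_add] at *
    omega
  · simp only [Nat.zero_add] at *
    omega
  · have h1 : m + 1 + 1 + 3 - 1 = m + 4 := by omega
    have h2 : m + 1 + 1 + 3 + n + 1 - 1 = m + n + 5 := by omega
    rw [h1, h2]
    nlinarith

/-- for coprime integers `a, b ≥ 3` and `g = (a−1)(b−1)/2 ≥ 6`, the
triangle `Δ = conv{(0,0),(b,0),(0,a)}` satisfies `#(Δ ∩ ℤ²) − c(Δ) − 3 < 2g − 1`. -/
theorem triangle_moduli_bound (a b : ℕ) (ha : 3 ≤ a) (hb : 3 ≤ b)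
    (hab : Nat.Coprime a b) (hg : 6 ≤ (a - 1) * (b - 1) / 2) :
    ((latticePts (convexHull ℝ
        ({((0 : ℝ), (0 : ℝ)), ((b : ℝ), 0), (0, (a : ℝ))} : Set (ℝ × ℝ)))).ncard : ℤ) -
      (colCount (convexHull ℝ
        ({((0 : ℝ), (0 : ℝ)), ((b : ℝ), 0), (0, (a : ℝ))} : Set (ℝ × ℝ))) : ℤ) - 3 <
      2 * (((a - 1) * (b - 1) / 2 : ℕ) : ℤ) - 1 := by
  have ha0 : 0 < a := by omega
  have hb0 : 0 < b := by omega
  have hne : a ≠ b := by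
    rintro rfl
    rw [Nat.coprime_self] at hab
    omega
  rw [latticePts_triangle ha0 hb0, Set.ncard_coe_finset]
  have hcard := two_mul_card_triangleFinset ha0 hb0 hab
  have hcol := le_colCount_triangle ha0 hb0
  have hprod : (a + 1) * (b + 1) = (a - 1) * (b - 1) + 2 * (a + b) := by
    obtain ⟨m, rfl⟩ := Nat.exists_eq_add_of_le' ha0
    obtain ⟨n, rfl⟩ := Nat.exists_eq_add_of_le' hb0
    simp only [Nat.add_sub_cancel]
    ring
  have hbound : 2 * (a + b) ≤ (a - 1) * (b - 1) + 2 * (b / a + a / b + 2) + 1 := by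
    rcases lt_or_gt_of_ne hne with h | h
    · have := two_mul_add_le_of_lt ha h (by omega)
      rw [Nat.div_eq_of_lt h]
      omega
    · have := two_mul_add_le_of_lt hb h (by rw [mul_comm]; omega)
      rw [mul_comm (b - 1)] at this
      rw [Nat.div_eq_of_lt h]
      omega
  omega
end
end

section
/- For every integer h ≥ 2, the rectangular lattice polytope Δ = conv{(0,0),(h+1,0),(h+1,3),(0,3)} ⊂ ℝ² satisfies: #(Δ ∩ ℤ²) = 4h + 8, Δ has exactly 2h interior lattice points, c(Δ) = 4, and Δ is maximal. -/
noncomputable section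

/-- The closed rectangle `[0, w] × [0, d]`. -/
def rect (w d : ℝ) : Set (ℝ × ℝ) := Set.Icc 0 w ×ˢ Set.Icc 0 d

lemma mem_rect {w d : ℝ} {p : ℝ × ℝ} :
    p ∈ rect w d ↔ (0 ≤ p.1 ∧ p.1 ≤ w) ∧ 0 ≤ p.2 ∧ p.2 ≤ d := Iff.rfl

lemma convexHull_corners {w d : ℝ} (hw : 0 ≤ w) (hd : 0 ≤ d) :
    convexHull ℝ ({(0, 0), (w, 0), (w, d), (0, d)} : Set (ℝ × ℝ)) = rect w d := by
  have hcorners : ({(0, 0), (w, 0), (w, d), (0, d)} : Set (ℝ × ℝ)) =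
      ({0, w} : Set ℝ) ×ˢ ({0, d} : Set ℝ) := by
    ext ⟨x, y⟩
    simp only [Set.mem_insert_iff, Set.mem_singleton_iff, Prod.mk.injEq, Set.mem_prod]
    tauto
  rw [hcorners, convexHull_prod, convexHull_pair, convexHull_pair, segment_eq_Icc hw,
    segment_eq_Icc hd, rect]

lemma mem_interior_rect {w d : ℝ} {p : ℝ × ℝ} :
    p ∈ interior (rect w d) ↔ (0 < p.1 ∧ p.1 < w) ∧ 0 < p.2 ∧ p.2 < d := by
  rw [rect, interior_prod_eq, interior_Icc, interior_Icc]
  rfl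

lemma convex_rect (w d : ℝ) : Convex ℝ (rect w d) :=
  (convex_Icc 0 w).prod (convex_Icc 0 d)

lemma toR2_mem_rect {m n : ℕ} {p : ℤ × ℤ} :
    toR2 p ∈ rect m n ↔ (0 ≤ p.1 ∧ p.1 ≤ m) ∧ 0 ≤ p.2 ∧ p.2 ≤ n := by
  rw [mem_rect]
  simp only [toR2]
  norm_cast

lemma toR2_mem_interior_rect {m n : ℕ} {p : ℤ × ℤ} :
    toR2 p ∈ interior (rect m n) ↔ (0 < p.1 ∧ p.1 < m) ∧ 0 < p.2 ∧ p.2 < n := by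
  rw [mem_interior_rect]
  simp only [toR2]
  norm_cast

lemma ncard_latticePts_rect (m n : ℕ) :
    (latticePts (rect m n)).ncard = (m + 1) * (n + 1) := by
  have hpts : latticePts (rect m n) =
      ((Finset.Icc (0 : ℤ) m ×ˢ Finset.Icc (0 : ℤ) n : Finset (ℤ × ℤ)) : Set (ℤ × ℤ)) := by
    ext p
    simp only [latticePts, Set.mem_ofPred_eq, toR2_mem_rect, Finset.coe_product, Finset.coe_Icc,
      Set.mem_prod, Set.mem_Icc]
  rw [hpts, Set.ncard_coe_finset, Finset.card_product, Int.card_Icc, Int.card_Icc]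
  congr 1

lemma ncard_intPts_rect (m n : ℕ) :
    (intPts (rect m n)).ncard = (m - 1) * (n - 1) := by
  have hpts : intPts (rect m n) =
      ((Finset.Ioo (0 : ℤ) m ×ˢ Finset.Ioo (0 : ℤ) n : Finset (ℤ × ℤ)) : Set (ℤ × ℤ)) := by
    ext p
    simp [intPts, toR2_mem_interior_rect]
  rw [hpts, Set.ncard_coe_finset, Finset.card_product, Int.card_Ioo, Int.card_Ioo]
  congr 1 <;> omega

/-- A collinear exposed face of a nondegenerate rectangle lies on one of its four sides. -/
lemma IsFacet.subset_side {w d : ℝ} (hw : 0 < w) (hd : 0 < d) {τ : Set (ℝ × ℝ)}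
    (hτ : IsFacet (rect w d) τ) :
    (∀ p ∈ τ, p.1 = w) ∨ (∀ p ∈ τ, p.1 = 0) ∨ (∀ p ∈ τ, p.2 = d) ∨ (∀ p ∈ τ, p.2 = 0) := by
  obtain ⟨hexp, hcol, hsub⟩ := hτ
  obtain ⟨l, hl⟩ := hexp (Set.not_subsingleton_iff.mp hsub).nonempty
  have hlin : ∀ x y : ℝ, l (x, y) = x * l (1, 0) + y * l (0, 1) := by
    intro x y
    have hxy : ((x, y) : ℝ × ℝ) = x • ((1, 0) : ℝ × ℝ) + y • ((0, 1) : ℝ × ℝ) := by simp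
    rw [hxy, map_add, map_smul, map_smul, smul_eq_mul, smul_eq_mul]
  have hmax : ∀ p ∈ τ, p ∈ rect w d ∧ ∀ x y : ℝ, (x, y) ∈ rect w d →
      x * l (1, 0) + y * l (0, 1) ≤ p.1 * l (1, 0) + p.2 * l (0, 1) := by
    intro p hp
    rw [hl] at hp
    exact ⟨hp.1, fun x y hxy => by rw [← hlin, ← hlin]; exact hp.2 (x, y) hxy⟩
  rcases lt_trichotomy (l (1, 0)) 0 with hα | hα | hα
  · refine Or.inr (Or.inl fun p hp => ?_)
    obtain ⟨⟨⟨h1, h2⟩, h3, h4⟩, h5⟩ := hmax p hp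
    have := h5 0 p.2 ⟨⟨le_rfl, hw.le⟩, h3, h4⟩
    nlinarith
  · rcases lt_trichotomy (l (0, 1)) 0 with hβ | hβ | hβ
    · refine Or.inr (Or.inr (Or.inr fun p hp => ?_))
      obtain ⟨⟨⟨h1, h2⟩, h3, h4⟩, h5⟩ := hmax p hp
      have := h5 p.1 0 ⟨⟨h1, h2⟩, le_rfl, hd.le⟩
      nlinarith
    · exfalso
      have hall : ∀ x y : ℝ, (x, y) ∈ rect w d → (x, y) ∈ τ := by
        intro x y hxy
        rw [hl]
        refine ⟨hxy, fun q _ => ?_⟩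
        rw [hlin x y, ← Prod.mk.eta (p := q), hlin q.1 q.2, hα, hβ]
        simp
      have h0 := hall 0 0 ⟨⟨le_rfl, hw.le⟩, le_rfl, hd.le⟩
      have h1 := hall w 0 ⟨⟨hw.le, le_rfl⟩, le_rfl, hd.le⟩
      have h2 := hall 0 d ⟨⟨le_rfl, hw.le⟩, hd.le, le_rfl⟩
      obtain ⟨v, hv⟩ := (collinear_iff_of_mem h0).1 hcol
      obtain ⟨r, hr⟩ := hv _ h1
      obtain ⟨s, hs⟩ := hv _ h2
      simp only [vadd_eq_add, Prod.ext_iff, Prod.fst_add, Prod.snd_add, Prod.smul_fst,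
        Prod.smul_snd, smul_eq_mul, add_zero] at hr hs
      have hwd : w * d = 0 := by
        calc w * d = r * v.1 * (s * v.2) := by rw [← hr.1, ← hs.2]
          _ = s * v.1 * (r * v.2) := by ring
          _ = 0 := by rw [← hs.1, zero_mul]
      exact (mul_pos hw hd).ne' hwd
    · refine Or.inr (Or.inr (Or.inl fun p hp => ?_))
      obtain ⟨⟨⟨h1, h2⟩, h3, h4⟩, h5⟩ := hmax p hp
      have := h5 p.1 d ⟨⟨h1, h2⟩, hd.le, le_rfl⟩
      nlinarith
  · refine Or.inl fun p hp => ?_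
    obtain ⟨⟨⟨h1, h2⟩, h3, h4⟩, h5⟩ := hmax p hp
    have := h5 w p.2 ⟨⟨hw.le, le_rfl⟩, h3, h4⟩
    nlinarith

lemma collinear_of_fst_eq {τ : Set (ℝ × ℝ)} {c : ℝ} (hτ : ∀ p ∈ τ, p.1 = c) :
    Collinear ℝ τ :=
  (collinear_iff_exists_forall_eq_smul_vadd τ).2
    ⟨(c, 0), (0, 1), fun p hp => ⟨p.2, by simp [Prod.ext_iff, hτ p hp]⟩⟩

lemma collinear_of_snd_eq {τ : Set (ℝ × ℝ)} {c : ℝ} (hτ : ∀ p ∈ τ, p.2 = c) :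
    Collinear ℝ τ :=
  (collinear_iff_exists_forall_eq_smul_vadd τ).2
    ⟨(0, c), (1, 0), fun p hp => ⟨p.1, by simp [Prod.ext_iff, hτ p hp]⟩⟩

lemma isFacet_right {w d : ℝ} (hw : 0 ≤ w) (hd : 0 < d) :
    IsFacet (rect w d) {p ∈ rect w d | p.1 = w} := by
  refine ⟨fun _ => ⟨ContinuousLinearMap.fst ℝ ℝ ℝ, ?_⟩, collinear_of_fst_eq fun p hp => hp.2, ?_⟩
  · ext p
    refine and_congr_right fun hp => ⟨fun h q hq => ?_, fun h => ?_⟩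
    · exact hq.1.2.trans h.ge
    · exact le_antisymm hp.1.2 (h (w, 0) ⟨⟨hw, le_rfl⟩, le_rfl, hd.le⟩)
  · intro h
    have := @h (w, 0) ⟨⟨⟨hw, le_rfl⟩, le_rfl, hd.le⟩, rfl⟩
      (w, d) ⟨⟨⟨hw, le_rfl⟩, hd.le, le_rfl⟩, rfl⟩
    exact hd.ne (congrArg Prod.snd this)

lemma isFacet_left_s12 {w d : ℝ} (hw : 0 ≤ w) (hd : 0 < d) :
    IsFacet (rect w d) {p ∈ rect w d | p.1 = 0} := by
  refine ⟨fun _ => ⟨-ContinuousLinearMap.fst ℝ ℝ ℝ, ?_⟩, collinear_of_fst_eq fun p hp => hp.2, ?_⟩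
  · ext p
    refine and_congr_right fun hp => ⟨fun h q hq => ?_, fun h => ?_⟩
    · exact neg_le_neg (h.le.trans hq.1.1)
    · exact le_antisymm (neg_le_neg_iff.1 (h (0, 0) ⟨⟨le_rfl, hw⟩, le_rfl, hd.le⟩)) hp.1.1
  · intro h
    have := @h (0, 0) ⟨⟨⟨le_rfl, hw⟩, le_rfl, hd.le⟩, rfl⟩
      (0, d) ⟨⟨⟨le_rfl, hw⟩, hd.le, le_rfl⟩, rfl⟩
    exact hd.ne (congrArg Prod.snd this)

lemma isFacet_top {w d : ℝ} (hw : 0 < w) (hd : 0 ≤ d) :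
    IsFacet (rect w d) {p ∈ rect w d | p.2 = d} := by
  refine ⟨fun _ => ⟨ContinuousLinearMap.snd ℝ ℝ ℝ, ?_⟩, collinear_of_snd_eq fun p hp => hp.2, ?_⟩
  · ext p
    refine and_congr_right fun hp => ⟨fun h q hq => ?_, fun h => ?_⟩
    · exact hq.2.2.trans h.ge
    · exact le_antisymm hp.2.2 (h (0, d) ⟨⟨le_rfl, hw.le⟩, hd, le_rfl⟩)
  · intro h
    have := @h (0, d) ⟨⟨⟨le_rfl, hw.le⟩, hd, le_rfl⟩, rfl⟩
      (w, d) ⟨⟨⟨hw.le, le_rfl⟩, hd, le_rfl⟩, rfl⟩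
    exact hw.ne (congrArg Prod.fst this)

lemma isFacet_bottom_s12 {w d : ℝ} (hw : 0 < w) (hd : 0 ≤ d) :
    IsFacet (rect w d) {p ∈ rect w d | p.2 = 0} := by
  refine ⟨fun _ => ⟨-ContinuousLinearMap.snd ℝ ℝ ℝ, ?_⟩, collinear_of_snd_eq fun p hp => hp.2, ?_⟩
  · ext p
    refine and_congr_right fun hp => ⟨fun h q hq => ?_, fun h => ?_⟩
    · exact neg_le_neg (h.le.trans hq.2.1)
    · exact le_antisymm (neg_le_neg_iff.1 (h (0, 0) ⟨⟨le_rfl, hw.le⟩, le_rfl, hd⟩)) hp.2.1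
  · intro h
    have := @h (0, 0) ⟨⟨⟨le_rfl, hw.le⟩, le_rfl, hd⟩, rfl⟩
      (w, 0) ⟨⟨⟨hw.le, le_rfl⟩, le_rfl, hd⟩, rfl⟩
    exact hw.ne (congrArg Prod.fst this)

lemma isColumnVector_rect_iff {m n : ℕ} (hm : 2 ≤ m) (hn : 2 ≤ n) {v : ℤ × ℤ} :
    IsColumnVector (rect m n) v ↔ v = (1, 0) ∨ v = (-1, 0) ∨ v = (0, 1) ∨ v = (0, -1) := by
  have hm0 : (0 : ℝ) < m := by exact_mod_cast (by omega : 0 < m)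
  have hn0 : (0 : ℝ) < n := by exact_mod_cast (by omega : 0 < n)
  constructor
  · rintro ⟨hv, τ, hτ, hshift⟩
    obtain ⟨a, b⟩ := v
    have hab : ¬ (a = 0 ∧ b = 0) := fun h => hv (by simp [h.1, h.2])
    have hmove : ∀ x y : ℤ, (0 ≤ x ∧ x ≤ m) ∧ 0 ≤ y ∧ y ≤ n → toR2 (x, y) ∉ τ →
        (0 ≤ x + a ∧ x + a ≤ m) ∧ 0 ≤ y + b ∧ y + b ≤ n := fun x y hxy hnot =>
      toR2_mem_rect.1 (hshift (x, y) ⟨toR2_mem_rect.2 hxy, hnot⟩)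
    simp only [Prod.mk.injEq]
    rcases hτ.subset_side hm0 hn0 with hs | hs | hs | hs
    · have hout : ∀ x y : ℤ, x ≠ m → toR2 (x, y) ∉ τ := fun x y hx hp =>
        hx (by exact_mod_cast (show (x : ℝ) = m from hs _ hp))
      have h1 := hmove 0 0 (by omega) (hout _ _ (by omega))
      have h2 := hmove 0 n (by omega) (hout _ _ (by omega))
      have h3 := hmove (m - 1) 0 (by omega) (hout _ _ (by omega))
      omega
    · have hout : ∀ x y : ℤ, x ≠ 0 → toR2 (x, y) ∉ τ := fun x y hx hp =>
        hx (by exact_mod_cast (show (x : ℝ) = 0 from hs _ hp))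
      have h1 := hmove m 0 (by omega) (hout _ _ (by omega))
      have h2 := hmove m n (by omega) (hout _ _ (by omega))
      have h3 := hmove 1 0 (by omega) (hout _ _ (by omega))
      omega
    · have hout : ∀ x y : ℤ, y ≠ n → toR2 (x, y) ∉ τ := fun x y hy hp =>
        hy (by exact_mod_cast (show (y : ℝ) = n from hs _ hp))
      have h1 := hmove 0 0 (by omega) (hout _ _ (by omega))
      have h2 := hmove m 0 (by omega) (hout _ _ (by omega))
      have h3 := hmove 0 (n - 1) (by omega) (hout _ _ (by omega))
      omega
    · have hout : ∀ x y : ℤ, y ≠ 0 → toR2 (x, y) ∉ τ := fun x y hy hp =>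
        hy (by exact_mod_cast (show (y : ℝ) = 0 from hs _ hp))
      have h1 := hmove 0 n (by omega) (hout _ _ (by omega))
      have h2 := hmove m n (by omega) (hout _ _ (by omega))
      have h3 := hmove 0 1 (by omega) (hout _ _ (by omega))
      omega
  · rintro (rfl | rfl | rfl | rfl)
    · refine ⟨by simp, _, isFacet_right hm0.le hn0, fun p hp => ?_⟩
      have hne : p.1 ≠ m := fun h => hp.2 ⟨hp.1, by simp [toR2, h]⟩
      have hmem := toR2_mem_rect.1 hp.1
      rw [toR2_mem_rect, Prod.fst_add, Prod.snd_add]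
      dsimp only
      omega
    · refine ⟨by simp, _, isFacet_left_s12 hm0.le hn0, fun p hp => ?_⟩
      have hne : p.1 ≠ 0 := fun h => hp.2 ⟨hp.1, by simp [toR2, h]⟩
      have hmem := toR2_mem_rect.1 hp.1
      rw [toR2_mem_rect, Prod.fst_add, Prod.snd_add]
      dsimp only
      omega
    · refine ⟨by simp, _, isFacet_top hm0 hn0.le, fun p hp => ?_⟩
      have hne : p.2 ≠ n := fun h => hp.2 ⟨hp.1, by simp [toR2, h]⟩
      have hmem := toR2_mem_rect.1 hp.1
      rw [toR2_mem_rect, Prod.fst_add, Prod.snd_add]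
      dsimp only
      omega
    · refine ⟨by simp, _, isFacet_bottom_s12 hm0 hn0.le, fun p hp => ?_⟩
      have hne : p.2 ≠ 0 := fun h => hp.2 ⟨hp.1, by simp [toR2, h]⟩
      have hmem := toR2_mem_rect.1 hp.1
      rw [toR2_mem_rect, Prod.fst_add, Prod.snd_add]
      dsimp only
      omega

lemma colCount_rect {m n : ℕ} (hm : 2 ≤ m) (hn : 2 ≤ n) : colCount (rect m n) = 4 := by
  have hcols : {v : ℤ × ℤ | IsColumnVector (rect m n) v} =
      (({(1, 0), (-1, 0), (0, 1), (0, -1)} : Finset (ℤ × ℤ)) : Set (ℤ × ℤ)) := by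
    ext v
    simp [isColumnVector_rect_iff hm hn]
  rw [colCount, hcols, Set.ncard_coe_finset]
  rfl

/-- If moving `p` slightly away from `q ∈ s` lands in the interior of the convex set `s`, then
`p` itself is an interior point of `s`. -/
lemma Convex.mem_interior_of_forall_extrapolate {s : Set (ℝ × ℝ)} (hs : Convex ℝ s)
    {p q : ℝ × ℝ} (hq : q ∈ s)
    (h : ∀ ε : ℝ, 0 < ε → |ε * (p.1 - q.1)| < 1 → |ε * (p.2 - q.2)| < 1 →
      (p.1 + ε * (p.1 - q.1), p.2 + ε * (p.2 - q.2)) ∈ interior s) :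
    p ∈ interior s := by
  have hN : 0 < |p.1 - q.1| + |p.2 - q.2| + 1 := by positivity
  set ε : ℝ := 1 / (|p.1 - q.1| + |p.2 - q.2| + 1) with hε
  have hε0 : 0 < ε := by positivity
  have hlt : ∀ t : ℝ, |t| < |p.1 - q.1| + |p.2 - q.2| + 1 → |ε * t| < 1 := by
    intro t ht
    rw [abs_mul, abs_of_pos hε0, hε, one_div_mul_eq_div, div_lt_one hN]
    exact ht
  have hint := h ε hε0 (hlt _ (by linarith [abs_nonneg (p.2 - q.2)]))
    (hlt _ (by linarith [abs_nonneg (p.1 - q.1)]))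
  refine hs.openSegment_interior_self_subset_interior hint hq
    ⟨1 / (1 + ε), ε / (1 + ε), by positivity, by positivity, by field_simp, ?_⟩
  ext <;> simp <;> field_simp <;> ring

lemma isMaximalPolytope_rect {m n : ℕ} (hm : 2 ≤ m) (hn : 2 ≤ n) :
    IsMaximalPolytope (rect m n) := by
  have hm2 : (2 : ℝ) ≤ m := by exact_mod_cast hm
  have hn2 : (2 : ℝ) ≤ n := by exact_mod_cast hn
  rintro Δ' ⟨S, rfl⟩ hss heq
  set Δ' := convexHull ℝ (toR2 '' (S : Set (ℤ × ℤ)))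
  have hconv : Convex ℝ Δ' := convex_convexHull ℝ _
  obtain ⟨⟨a, b⟩, haS, hout⟩ : ∃ q ∈ S, toR2 q ∉ rect m n := by
    by_contra! hall
    refine hss.2 (convexHull_min ?_ (convex_rect _ _))
    rintro _ ⟨q, hq, rfl⟩
    exact hall q hq
  have hq : toR2 (a, b) ∈ Δ' := subset_convexHull ℝ _ ⟨_, haS, rfl⟩
  have hkey : ∀ x y : ℤ, (∀ ε : ℝ, 0 < ε → |ε * (x - a)| < 1 → |ε * (y - b)| < 1 →
      (0 < x + ε * (x - a) ∧ x + ε * (x - a) < m) ∧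
        0 < y + ε * (y - b) ∧ y + ε * (y - b) < n) →
      (0 < x ∧ x < m) ∧ 0 < y ∧ y < n := by
    intro x y hxy
    have hint : (x, y) ∈ intPts Δ' :=
      hconv.mem_interior_of_forall_extrapolate (p := toR2 (x, y)) hq fun ε h0 h1 h2 =>
        interior_mono hss.1 (mem_interior_rect.2 (hxy ε h0 h1 h2))
    rw [heq] at hint
    exact toR2_mem_interior_rect.1 hint
  rw [toR2_mem_rect] at hout
  have hcases : a < 0 ∨ (m : ℤ) < a ∨ b < 0 ∨ (n : ℤ) < b := by
    dsimp only at hout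
    omega
  rcases hcases with ha | ha | hb | hb
  · have := hkey 0 1 fun ε h0 h1 h2 => by
      have ha' : (a : ℝ) < 0 := by exact_mod_cast ha
      rw [abs_lt] at h1 h2
      push_cast at h1 h2 ⊢
      have := mul_pos h0 (sub_pos.2 ha')
      refine ⟨⟨?_, ?_⟩, ?_, ?_⟩ <;> linarith
    omega
  · have := hkey m 1 fun ε h0 h1 h2 => by
      have ha' : (m : ℝ) < a := by exact_mod_cast ha
      rw [abs_lt] at h1 h2
      push_cast at h1 h2 ⊢
      have := mul_pos h0 (sub_pos.2 ha')
      refine ⟨⟨?_, ?_⟩, ?_, ?_⟩ <;> linarith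
    omega
  · have := hkey 1 0 fun ε h0 h1 h2 => by
      have hb' : (b : ℝ) < 0 := by exact_mod_cast hb
      rw [abs_lt] at h1 h2
      push_cast at h1 h2 ⊢
      have := mul_pos h0 (sub_pos.2 hb')
      refine ⟨⟨?_, ?_⟩, ?_, ?_⟩ <;> linarith
    omega
  · have := hkey 1 n fun ε h0 h1 h2 => by
      have hb' : (n : ℝ) < b := by exact_mod_cast hb
      rw [abs_lt] at h1 h2
      push_cast at h1 h2 ⊢
      have := mul_pos h0 (sub_pos.2 hb')
      refine ⟨⟨?_, ?_⟩, ?_, ?_⟩ <;> linarith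
    omega

/-- for every integer `h ≥ 2`, the rectangle
`Δ = conv{(0,0),(h+1,0),(h+1,3),(0,3)}` has `4h+8` lattice points, exactly `2h`
interior lattice points, `c(Δ) = 4`, and is maximal. -/
theorem rectangle_counts (h : ℕ) (hh : 2 ≤ h) :
    (latticePts (convexHull ℝ
        ({((0 : ℝ), (0 : ℝ)), (((h + 1 : ℕ) : ℝ), 0), (((h + 1 : ℕ) : ℝ), 3), (0, 3)} :
          Set (ℝ × ℝ)))).ncard = 4 * h + 8 ∧
    (intPts (convexHull ℝ
        ({((0 : ℝ), (0 : ℝ)), (((h + 1 : ℕ) : ℝ), 0), (((h + 1 : ℕ) : ℝ), 3), (0, 3)} :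
          Set (ℝ × ℝ)))).ncard = 2 * h ∧
    colCount (convexHull ℝ
        ({((0 : ℝ), (0 : ℝ)), (((h + 1 : ℕ) : ℝ), 0), (((h + 1 : ℕ) : ℝ), 3), (0, 3)} :
          Set (ℝ × ℝ))) = 4 ∧
    IsMaximalPolytope (convexHull ℝ
        ({((0 : ℝ), (0 : ℝ)), (((h + 1 : ℕ) : ℝ), 0), (((h + 1 : ℕ) : ℝ), 3), (0, 3)} :
          Set (ℝ × ℝ))) := by
  have hrect : convexHull ℝ
      ({((0 : ℝ), (0 : ℝ)), (((h + 1 : ℕ) : ℝ), 0), (((h + 1 : ℕ) : ℝ), 3), (0, 3)} :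
        Set (ℝ × ℝ)) = rect (h + 1 : ℕ) (3 : ℕ) := by
    rw [convexHull_corners (Nat.cast_nonneg _) (by norm_num), Nat.cast_ofNat]
  rw [hrect]
  refine ⟨?_, ?_, colCount_rect (by omega) (by omega),
    isMaximalPolytope_rect (by omega) (by omega)⟩
  · rw [ncard_latticePts_rect]
    ring
  · rw [ncard_intPts_rect]
    omega
end
end
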